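/- arXiv:1111.1613 — 3 statements merged into one kernel-verified Lean document; each statement's English description precedes it below -/
import Mathlib

section
/- Let n ≥ 2 and let B be a real symmetric (n+1)×(n+1) matrix such that Σ_{j,k=1}^{n+1} a_j a_k B_{jk} = 0 for every vector a ∈ ℝ^{n+1} satisfying a_1² + ⋯ + a_n² = a_{n+1}². Then B_{jk} = 0 for all j ≠ k, B_{11} = B_{22} = ⋯ = B_{nn}, and B_{(n+1)(n+1)} = −B_{11}; that is, B is a scalar multiple of the Minkowski metric matrix η = diag(1, …, 1, −1). -/
open scoped BigOperators
open Matrix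

noncomputable section

/-- Sign vector of the Minkowski metric: `+1` for the first `n` coordinates, `-1` for the last. -/
def eps (n : ℕ) (i : Fin (n + 1)) : ℝ := if i = Fin.last n then -1 else 1

/-- The Minkowski bilinear form `η(u,v) = Σ_{i<n} u_i v_i − u_n v_n` on `ℝ^{n+1}`. -/
def eta (n : ℕ) (u v : Fin (n + 1) → ℝ) : ℝ := ∑ i, eps n i * u i * v i

/-- Partial derivative in the `i`-th coordinate direction. -/
def pd (n : ℕ) (f : (Fin (n + 1) → ℝ) → ℝ) (i : Fin (n + 1)) (x : Fin (n + 1) → ℝ) : ℝ :=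
  fderiv ℝ f x (Pi.single i 1)

/-- The wave operator `□φ = Σ_{i=1}^n ∂²φ/∂x_i² − ∂²φ/∂x_{n+1}²`. -/
def waveOp (n : ℕ) (f : (Fin (n + 1) → ℝ) → ℝ) (x : Fin (n + 1) → ℝ) : ℝ :=
  ∑ i, eps n i * pd n (pd n f i) i x

/-- The causal order on Minkowski space: `x ≤ y` iff `y − x` is causal and future-pointing. -/
def causalLe (n : ℕ) (x y : Fin (n + 1) → ℝ) : Prop :=
  eta n (y - x) (y - x) ≤ 0 ∧ x (Fin.last n) ≤ y (Fin.last n)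

/-- A causal automorphism: a bijection preserving the causal order in both directions. -/
def IsCausalAuto (n : ℕ) (F : (Fin (n + 1) → ℝ) → (Fin (n + 1) → ℝ)) : Prop :=
  Function.Bijective F ∧ ∀ x y, causalLe n x y ↔ causalLe n (F x) (F y)

/-- The matrix `η = diag(1, …, 1, −1)`. -/
def etaM (n : ℕ) : Matrix (Fin (n + 1)) (Fin (n + 1)) ℝ := Matrix.diagonal (eps n)

/-- A Lorentz matrix: `Aᵀ η A = η`. -/
def IsLorentz (n : ℕ) (A : Matrix (Fin (n + 1)) (Fin (n + 1)) ℝ) : Prop :=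
  Aᵀ * etaM n * A = etaM n

/-- The `i`-th row of the Jacobian of `F` at `x`. -/
def jacRow (n : ℕ) (F : (Fin (n + 1) → ℝ) → (Fin (n + 1) → ℝ)) (i : Fin (n + 1))
    (x : Fin (n + 1) → ℝ) : Fin (n + 1) → ℝ :=
  fun j => pd n (fun z => F z i) j x

theorem eta_eq_dotProduct_mulVec (n : ℕ) (u v : Fin (n + 1) → ℝ) :
    eta n u v = u ⬝ᵥ (etaM n *ᵥ v) := by
  simp only [eta, etaM, dotProduct, mulVec_diagonal]
  exact Finset.sum_congr rfl fun i _ => by ring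

/-- The quadratic form of a symmetric matrix on a vector with at most three nonzero entries. -/
theorem Matrix.IsSymm.dotProduct_mulVec_three_single {ι R : Type*} [Fintype ι] [DecidableEq ι]
    [CommRing R] {B : Matrix ι ι R} (hB : B.IsSymm) (i j l : ι) (p q r : R) :
    (Pi.single i p + Pi.single j q + Pi.single l r) ⬝ᵥ
        (B *ᵥ (Pi.single i p + Pi.single j q + Pi.single l r)) =
      p ^ 2 * B i i + q ^ 2 * B j j + r ^ 2 * B l l
        + 2 * p * q * B i j + 2 * p * r * B i l + 2 * q * r * B j l := by
  simp only [add_dotProduct, mulVec_add, dotProduct_add, single_dotProduct, mulVec_single,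
    Pi.smul_apply, col_apply, op_smul_eq_mul, hB.apply i j, hB.apply i l, hB.apply j l]
  ring

/-- A symmetric bilinear form on `ℝ^{n+1}` (with `n ≥ 2`) vanishing on all Minkowski-null
vectors is a scalar multiple of the Minkowski metric `η = diag(1, …, 1, −1)`: its
off-diagonal entries vanish, its first `n` diagonal entries coincide, and its last diagonal
entry is the negative of the first. -/
theorem symm_matrix_vanishing_on_null_cone (n : ℕ) (hn : 2 ≤ n)
    (B : Matrix (Fin (n + 1)) (Fin (n + 1)) ℝ) (hsymm : B.IsSymm)
    (hnull : ∀ a : Fin (n + 1) → ℝ, eta n a a = 0 → ∑ j, ∑ k, a j * a k * B j k = 0) :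
    (∀ j k, j ≠ k → B j k = 0) ∧
    (∀ i j, i ≠ Fin.last n → j ≠ Fin.last n → B i i = B j j) ∧
    (B (Fin.last n) (Fin.last n) = - B 0 0) ∧
    (∃ c : ℝ, B = c • etaM n) := by
  have key : ∀ i j, i ≠ Fin.last n → j ≠ Fin.last n → ∀ p q r : ℝ, i ≠ j ∨ q = 0 →
      p ^ 2 + q ^ 2 = r ^ 2 →
      p ^ 2 * B i i + q ^ 2 * B j j + r ^ 2 * B (Fin.last n) (Fin.last n)
        + 2 * p * q * B i j + 2 * p * r * B i (Fin.last n) + 2 * q * r * B j (Fin.last n) = 0 := by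
    intro i j hi hj p q r hij hpq
    rw [← hsymm.dotProduct_mulVec_three_single]
    set a : Fin (n + 1) → ℝ := Pi.single i p + Pi.single j q + Pi.single (Fin.last n) r with ha
    have h := hnull a ?_
    · rw [← h]
      simp only [dotProduct, mulVec, Finset.mul_sum]
      exact Finset.sum_congr rfl fun _ _ => Finset.sum_congr rfl fun _ _ => by ring
    · have hη : (etaM n).IsSymm := isSymm_diagonal _
      rw [eta_eq_dotProduct_mulVec, ha, hη.dotProduct_mulVec_three_single]
      rcases hij with hij | rfl
      · simp [etaM, eps, hi, hj, hij]
        linarith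
      · simp [etaM, eps, hi, hj] at hpq ⊢
        linarith
  have hlast : ∀ i, i ≠ Fin.last n →
      B i (Fin.last n) = 0 ∧ B (Fin.last n) (Fin.last n) = - B i i := by
    intro i hi
    have h₁ := key i i hi hi 1 0 1 (Or.inr rfl) (by norm_num)
    have h₂ := key i i hi hi 1 0 (-1) (Or.inr rfl) (by norm_num)
    constructor <;> linarith
  have hoff : ∀ j k, j ≠ k → B j k = 0 := by
    intro j k hjk
    by_cases hj : j = Fin.last n
    · subst hj
      rw [← hsymm.apply]
      exact (hlast k hjk.symm).1
    by_cases hk : k = Fin.last n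
    · subst hk
      exact (hlast j hj).1
    have h := key j k hj hk 3 4 5 (Or.inl hjk) (by norm_num)
    linarith [hlast j hj, hlast k hk]
  have h0 : (0 : Fin (n + 1)) ≠ Fin.last n := by
    rw [Ne, Fin.ext_iff, Fin.val_zero, Fin.val_last]
    omega
  refine ⟨hoff, fun i j hi hj => ?_, (hlast 0 h0).2, B 0 0, ?_⟩
  · linarith [(hlast i hi).2, (hlast j hj).2]
  · ext i j
    by_cases hij : i = j
    · subst hij
      by_cases hi : i = Fin.last n
      · simp [etaM, eps, hi, (hlast 0 h0).2]
      · simp only [etaM, eps, Matrix.smul_apply, diagonal_apply_eq, if_neg hi, smul_eq_mul, mul_one]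
        linarith [(hlast i hi).2, (hlast 0 h0).2]
    · simp [etaM, hij, hoff i j hij]
end
end

section
/- Let n ≥ 1, let α be a nonzero real number, let A be an (n+1)×(n+1) Lorentz matrix, and let b ∈ ℝ^{n+1}. Define F : ℝ^{n+1} → ℝ^{n+1} by F(x) = α·(A x) + b. Then for every twice continuously differentiable function φ : ℝ^{n+1} → ℝ and every x ∈ ℝ^{n+1}, □(φ∘F)(x) = α²·(□φ)(F(x)). In particular, □(φ∘F) = 0 on ℝ^{n+1} if and only if □φ = 0 on ℝ^{n+1}. -/
open scoped BigOperators
open Matrix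

noncomputable section

theorem eps_mul_self (n : ℕ) (i : Fin (n + 1)) : eps n i * eps n i = 1 := by
  unfold eps
  split_ifs <;> norm_num

theorem etaM_mul_self (n : ℕ) : etaM n * etaM n = 1 := by
  simp [etaM, eps_mul_self]

theorem IsLorentz.mul_etaM_mul_transpose {n : ℕ} {A : Matrix (Fin (n + 1)) (Fin (n + 1)) ℝ}
    (hA : IsLorentz n A) : A * etaM n * Aᵀ = etaM n := by
  have h₁ : (etaM n * Aᵀ * etaM n) * A = 1 := by
    have h := congrArg (etaM n * ·) hA
    simpa only [etaM_mul_self, Matrix.mul_assoc] using h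
  have h₂ := congrArg (· * etaM n) (mul_eq_one_comm.mp h₁)
  simpa only [Matrix.mul_assoc, etaM_mul_self, Matrix.mul_one, Matrix.one_mul] using h₂

theorem IsLorentz.sum_eps_mul_mul {n : ℕ} {A : Matrix (Fin (n + 1)) (Fin (n + 1)) ℝ}
    (hA : IsLorentz n A) (j k : Fin (n + 1)) :
    ∑ i, eps n i * (A j i * A k i) = if j = k then eps n j else 0 := by
  have h := congrFun (congrFun hA.mul_etaM_mul_transpose j) k
  rw [Matrix.mul_apply] at h
  simp only [etaM, Matrix.mul_diagonal, Matrix.transpose_apply, Matrix.diagonal_apply] at h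
  rw [← h]
  exact Finset.sum_congr rfl fun i _ => by ring

/-- The `η`-trace of a bilinear form is invariant under Lorentz matrices. -/
theorem IsLorentz.sum_eps_mul_bilin_col {n : ℕ} {A : Matrix (Fin (n + 1)) (Fin (n + 1)) ℝ}
    (hA : IsLorentz n A) (B : (Fin (n + 1) → ℝ) →L[ℝ] (Fin (n + 1) → ℝ) →L[ℝ] ℝ) :
    ∑ i, eps n i * B (A.col i) (A.col i) =
      ∑ i, eps n i * B (Pi.single i 1) (Pi.single i 1) := by
  have expand (i : Fin (n + 1)) : B (A.col i) (A.col i) =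
      ∑ j, ∑ k, A j i * A k i * B (Pi.single j 1) (Pi.single k 1) := by
    conv_lhs => rw [pi_eq_sum_univ' (A.col i)]
    simp only [map_sum, map_smul, _root_.sum_apply,
      _root_.smul_apply, smul_eq_mul, Finset.mul_sum, Matrix.col_apply]
    rw [Finset.sum_comm]
    refine Finset.sum_congr rfl fun j _ => Finset.sum_congr rfl fun k _ => ?_
    ring
  calc ∑ i, eps n i * B (A.col i) (A.col i)
      = ∑ j, ∑ k, (∑ i, eps n i * (A j i * A k i)) *
          B (Pi.single j 1) (Pi.single k 1) := by
        simp only [expand, Finset.mul_sum, Finset.sum_mul]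
        rw [Finset.sum_comm]
        refine Finset.sum_congr rfl fun j _ => ?_
        rw [Finset.sum_comm]
        exact Finset.sum_congr rfl fun k _ => Finset.sum_congr rfl fun i _ => by ring
    _ = _ := by simp [hA.sum_eps_mul_mul]

theorem pd_pd_eq_fderiv_fderiv {n : ℕ} {f : (Fin (n + 1) → ℝ) → ℝ} (hf : ContDiff ℝ 2 f)
    (i : Fin (n + 1)) (x : Fin (n + 1) → ℝ) :
    pd n (pd n f i) i x = fderiv ℝ (fderiv ℝ f) x (Pi.single i 1) (Pi.single i 1) := by
  have hd : DifferentiableAt ℝ (fderiv ℝ f) x :=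
    (hf.fderiv_right (m := 1) (by norm_num)).differentiable (by norm_num) x
  have h := hd.hasFDerivAt.clm_apply (hasFDerivAt_const (Pi.single i (1 : ℝ)) x)
  unfold pd
  rw [h.fderiv]
  simp

theorem fderiv_fderiv_comp_affine {E : Type*} [NormedAddCommGroup E] [NormedSpace ℝ E]
    {f : E → ℝ} (hf : ContDiff ℝ 2 f) {g : E → E} {L : E →L[ℝ] E}
    (hg : ∀ x, HasFDerivAt g L x) (x v w : E) :
    fderiv ℝ (fderiv ℝ (f ∘ g)) x v w = fderiv ℝ (fderiv ℝ f) (g x) (L v) (L w) := by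
  have hd : Differentiable ℝ (fderiv ℝ f) :=
    (hf.fderiv_right (m := 1) (by norm_num)).differentiable (by norm_num)
  have h₁ : fderiv ℝ (f ∘ g) = fun y => (fderiv ℝ f (g y)).comp L := by
    funext y
    exact ((hf.differentiable (by norm_num) (g y)).hasFDerivAt.comp y (hg y)).fderiv
  have h₂ := ((hd (g x)).hasFDerivAt.comp x (hg x)).clm_comp (hasFDerivAt_const L x)
  rw [h₁]
  erw [h₂.fderiv]
  simp

/-- If `F(x) = α • (A x) + b` with `α ≠ 0` and `A` a Lorentz matrix, then
`□(φ∘F) = α² · (□φ)∘F` for every `C²` function `φ`; in particular `φ∘F` solves the wave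
equation iff `φ` does. -/
theorem waveOp_comp_lorentz_affine (n : ℕ) (hn : 1 ≤ n) (α : ℝ) (hα : α ≠ 0)
    (A : Matrix (Fin (n + 1)) (Fin (n + 1)) ℝ) (hA : IsLorentz n A) (b : Fin (n + 1) → ℝ)
    (F : (Fin (n + 1) → ℝ) → (Fin (n + 1) → ℝ)) (hFdef : ∀ x, F x = α • A.mulVec x + b)
    (φ : (Fin (n + 1) → ℝ) → ℝ) (hφ : ContDiff ℝ 2 φ) :
    (∀ x, waveOp n (φ ∘ F) x = α ^ 2 * waveOp n φ (F x)) ∧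
    ((∀ x, waveOp n (φ ∘ F) x = 0) ↔ (∀ x, waveOp n φ x = 0)) := by
  set L : (Fin (n + 1) → ℝ) →L[ℝ] (Fin (n + 1) → ℝ) :=
    α • LinearMap.toContinuousLinearMap A.mulVecLin with hL
  have hFL : F = fun x => L x + b := funext fun x => by simp [hFdef, hL]
  have hF (x) : HasFDerivAt F L x := by
    rw [hFL]
    exact L.hasFDerivAt.add_const b
  have hφF : ContDiff ℝ 2 (φ ∘ F) := by
    rw [hFL]
    exact hφ.comp (L.contDiff.add contDiff_const)
  have key (x) : waveOp n (φ ∘ F) x = α ^ 2 * waveOp n φ (F x) := by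
    unfold waveOp
    simp only [pd_pd_eq_fderiv_fderiv hφF, pd_pd_eq_fderiv_fderiv hφ,
      fderiv_fderiv_comp_affine hφ hF]
    rw [← hA.sum_eps_mul_bilin_col, Finset.mul_sum]
    refine Finset.sum_congr rfl fun i _ => ?_
    simp [hL]
    ring
  have hsurj : Function.Surjective F := by
    have hA' : A * (etaM n * Aᵀ * etaM n) = 1 := by
      rw [← Matrix.mul_assoc, ← Matrix.mul_assoc, hA.mul_etaM_mul_transpose, etaM_mul_self]
    intro y
    refine ⟨α⁻¹ • (etaM n * Aᵀ * etaM n).mulVec (y - b), ?_⟩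
    rw [hFdef, Matrix.mulVec_smul, Matrix.mulVec_mulVec, hA', Matrix.one_mulVec,
      smul_inv_smul₀ hα, sub_add_cancel]
  refine ⟨key, ?_⟩
  simp only [key, mul_eq_zero, pow_eq_zero_iff two_ne_zero, hα, false_or]
  exact ⟨fun h y => by obtain ⟨x, rfl⟩ := hsurj y; exact h x, fun h x => h (F x)⟩
end
end

section
/- Let n ≥ 1 and let f : ℝ^{n+1} → ℝ be a smooth function such that for every x ∈ ℝ^{n+1} and every k ∈ {1, …, n+1} one has (□f)(x)·x_k + 2 ε_k (∂f/∂x_k)(x) = 0, where ε_1 = ⋯ = ε_n = 1 and ε_{n+1} = −1. Suppose moreover that at every point the Minkowski gradient grad_η f(x) = (∂f/∂x_1, …, ∂f/∂x_n, −∂f/∂x_{n+1})(x) is spacelike or zero, i.e. Σ_{k=1}^{n+1} ε_k (∂f/∂x_k)²(x) ≥ 0. Then f is constant (its gradient vanishes identically). -/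
open scoped BigOperators
open Matrix

noncomputable section

theorem contDiff_pd {n : ℕ} {f : (Fin (n + 1) → ℝ) → ℝ} (hf : ContDiff ℝ (⊤ : ℕ∞) f)
    (i : Fin (n + 1)) : ContDiff ℝ (⊤ : ℕ∞) (pd n f i) :=
  (hf.fderiv_right (m := (⊤ : ℕ∞)) (by simp)).clm_apply contDiff_const

theorem contDiff_waveOp {n : ℕ} {f : (Fin (n + 1) → ℝ) → ℝ} (hf : ContDiff ℝ (⊤ : ℕ∞) f) :
    ContDiff ℝ (⊤ : ℕ∞) (waveOp n f) :=
  ContDiff.sum fun i _ => contDiff_const.mul (contDiff_pd (contDiff_pd hf i) i)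

theorem fderiv_apply_eq_sum_pd {n : ℕ} (f : (Fin (n + 1) → ℝ) → ℝ) (x v : Fin (n + 1) → ℝ) :
    fderiv ℝ f x v = ∑ i, v i * pd n f i x := by
  conv_lhs => rw [pi_eq_sum_univ' v]
  simp [pd]

/-- A partial derivative of `c * w * x_i` in the direction `i`. -/
theorem pd_const_mul_mul_coord {n : ℕ} {w : (Fin (n + 1) → ℝ) → ℝ} {x : Fin (n + 1) → ℝ}
    (hw : DifferentiableAt ℝ w x) (c : ℝ) (i : Fin (n + 1)) :
    pd n (fun y => c * (w y * y i)) i x = c * (w x + x i * pd n w i x) := by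
  have h := (hw.hasFDerivAt.mul (hasFDerivAt_apply (𝕜 := ℝ) i x)).const_mul c
  have h' : HasFDerivAt (fun y => c * (w y * y i)) _ x := h
  simp [pd, h'.fderiv, mul_add]

/-- A differentiable function which is homogeneous of negative degree (in the sense of Euler's
identity) on the whole space vanishes. -/
theorem eq_zero_of_fderiv_apply_self {E : Type*} [NormedAddCommGroup E] [NormedSpace ℝ E]
    {w : E → ℝ} (hw : Differentiable ℝ w) (m : ℕ)
    (h : ∀ x, fderiv ℝ w x x = -((m + 1 : ℕ) : ℝ) * w x) (x : E) : w x = 0 := by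
  have hd : ∀ t : ℝ, HasDerivAt (fun t : ℝ => t ^ (m + 1) * w (t • x)) 0 t := by
    intro t
    have h1 : HasDerivAt (fun t : ℝ => t • x) x t := by
      simpa using (hasDerivAt_id t).smul_const x
    have h2 : HasDerivAt (fun t : ℝ => w (t • x)) (fderiv ℝ w (t • x) x) t :=
      (hw (t • x)).hasFDerivAt.comp_hasDerivAt t h1
    have h3 := (hasDerivAt_pow (m + 1) t).mul h2
    have h4 := h (t • x)
    rw [map_smul, smul_eq_mul] at h4
    refine h3.congr_deriv ?_
    rw [Nat.add_sub_cancel, pow_succ]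
    linear_combination t ^ m * h4
  have := is_const_of_deriv_eq_zero (fun t => (hd t).differentiableAt) (fun t => (hd t).deriv) 1 0
  simpa using this

/-- If a smooth function `f` on `ℝ^{n+1}` satisfies `(□f)·x_k + 2 ε_k ∂f/∂x_k = 0` for all
`k` at every point, and its Minkowski gradient is everywhere spacelike or zero, then `f` is
constant (its gradient vanishes identically). -/
theorem spacelike_gradient_euler_constant (n : ℕ) (hn : 1 ≤ n)
    (f : (Fin (n + 1) → ℝ) → ℝ) (hf : ContDiff ℝ (⊤ : ℕ∞) f)
    (heq : ∀ (x : Fin (n + 1) → ℝ) (k : Fin (n + 1)),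
      waveOp n f x * x k + 2 * eps n k * pd n f k x = 0)
    (hgrad : ∀ x : Fin (n + 1) → ℝ, 0 ≤ ∑ k, eps n k * (pd n f k x) ^ 2) :
    (∀ (x : Fin (n + 1) → ℝ) (k : Fin (n + 1)), pd n f k x = 0) ∧
    (∀ x y : Fin (n + 1) → ℝ, f x = f y) := by
  have hw : Differentiable ℝ (waveOp n f) := (contDiff_waveOp hf).differentiable (by simp)
  have hpd : ∀ k, pd n f k = fun y => (-(1 / 2) * eps n k) * (waveOp n f y * y k) := by
    intro k
    funext y
    linear_combination (eps n k / 2) * heq y k - pd n f k y * eps_mul_self n k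
  have heuler : ∀ x, fderiv ℝ (waveOp n f) x x = -((n + 2 + 1 : ℕ) : ℝ) * waveOp n f x := by
    intro x
    have hsum : waveOp n f x =
        ∑ k, -(1 / 2) * (waveOp n f x + x k * pd n (waveOp n f) k x) := by
      conv_lhs => rw [waveOp]
      refine Finset.sum_congr rfl fun k _ => ?_
      rw [hpd k, pd_const_mul_mul_coord (hw x)]
      linear_combination (-(1 / 2) * (waveOp n f x + x k * pd n (waveOp n f) k x)) *
        eps_mul_self n k
    rw [← Finset.mul_sum, Finset.sum_add_distrib, ← fderiv_apply_eq_sum_pd] at hsum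
    simp only [Finset.sum_const, Finset.card_univ, Fintype.card_fin, nsmul_eq_mul] at hsum
    push_cast at hsum ⊢
    linear_combination 2 * hsum
  have hzero : ∀ x k, pd n f k x = 0 := by
    intro x k
    simp [hpd k, eq_zero_of_fderiv_apply_self hw (n + 2) heuler x]
  refine ⟨hzero, is_const_of_fderiv_eq_zero (𝕜 := ℝ) (hf.differentiable (by simp)) fun x => ?_⟩
  ext1 v
  simp [fderiv_apply_eq_sum_pd, hzero]
end
end
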